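/- Let τ be in the complex upper half-plane, set q = e^{2πiτ}, and let u ∈ ℂ with u ∉ ℤτ + (1/2)ℤ, z = e^{2πiu}. Then N*(1,0,z;q) = (1/(1+z)) ( −2i η(2τ)⁴ / ( η(τ)² ϑ(2u;2τ) ) − 2i e^{−πiτ/2} z μ(2u, τ; 2τ) + 1 ). -/

import Mathlib

open Complex Real Filter

noncomputable section

/-- The Jacobi theta function ϑ(u;τ) = Σ_{ν∈ℤ+1/2} e^{πiν²τ + 2πiν(u+1/2)}. -/
def jTheta (u τ : ℂ) : ℂ :=
  ∑' n : ℤ, Complex.exp (π * I * ((n : ℂ) + 1/2)^2 * τ + 2 * π * I * ((n : ℂ) + 1/2) * (u + 1/2))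

/-- ϑ₀(u;τ) = Σ_{n∈ℤ} e^{πin²τ + 2πinu}. -/
def jTheta0 (u τ : ℂ) : ℂ :=
  ∑' n : ℤ, Complex.exp (π * I * (n : ℂ)^2 * τ + 2 * π * I * (n : ℂ) * u)

/-- ϑ₁(u;τ) = Σ_{n∈1/2+ℤ} e^{πin²τ + 2πinu}. -/
def jTheta1 (u τ : ℂ) : ℂ :=
  ∑' n : ℤ, Complex.exp (π * I * ((n : ℂ) + 1/2)^2 * τ + 2 * π * I * ((n : ℂ) + 1/2) * u)

/-- The Dedekind eta function. -/
def dedekindEta (τ : ℂ) : ℂ :=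
  Complex.exp (π * I * τ / 12) * ∏' n : ℕ, (1 - Complex.exp (2 * π * I * ((n : ℂ) + 1) * τ))

/-- The Lerch sum μ(u,v;τ). -/
def lerchMu (u v τ : ℂ) : ℂ :=
  Complex.exp (π * I * u) / jTheta v τ *
    ∑' n : ℤ, (-1 : ℂ) ^ n * Complex.exp (π * I * ((n : ℂ)^2 + (n : ℂ)) * τ + 2 * π * I * v * (n : ℂ)) /
      (1 - Complex.exp (2 * π * I * (n : ℂ) * τ + 2 * π * I * u))

/-- a₀^{α,β}(τ). -/
def aCoef0 (α β : ℝ) (τ : ℂ) : ℂ :=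
  ∑' n : ℤ, ((n : ℂ) + (α : ℂ)/2) *
    Complex.exp (2 * π * I * (n : ℂ)^2 * τ + 2 * π * I * (n : ℂ) * ((α : ℂ) * τ + (β : ℂ)))

/-- a₁^{α,β}(τ). -/
def aCoef1 (α β : ℝ) (τ : ℂ) : ℂ :=
  ∑' n : ℤ, (((n : ℂ) + 1/2) + (α : ℂ)/2) *
    Complex.exp (2 * π * I * ((n : ℂ) + 1/2)^2 * τ + 2 * π * I * ((n : ℂ) + 1/2) * ((α : ℂ) * τ + (β : ℂ)))

/-- Finite q-Pochhammer symbol (a;q)_n. -/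
def qPochN (a q : ℂ) (n : ℕ) : ℂ := ∏ j ∈ Finset.range n, (1 - a * q ^ j)

/-- Infinite q-Pochhammer symbol (a;q)_∞. -/
def qPochInf (a q : ℂ) : ℂ := ∏' j : ℕ, (1 - a * q ^ j)

/-- The modified rank generating function R*(z;q). -/
def rankStar (z q : ℂ) : ℂ :=
  (qPochInf q q)⁻¹ * ∑' n : ℤ, (-1 : ℂ) ^ n * q ^ (n * (3 * n + 1) / 2) / (1 - z * q ^ n)

/-- The modified crank generating function C*(z;q). -/
def crankStar (z q : ℂ) : ℂ :=
  (1 - z)⁻¹ * ∏' n : ℕ, ((1 - q ^ (n + 1)) / ((1 - z * q ^ (n + 1)) * (1 - z⁻¹ * q ^ (n + 1))))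

/-- N(1,0,z;q), the overpartition-rank generating function. -/
def nGen10 (z q : ℂ) : ℂ :=
  ∑' n : ℕ, qPochN (-1) q n * q ^ (n * (n + 1) / 2) / (qPochN (z * q) q n * qPochN (z⁻¹ * q) q n)

/-- N*(1,0,z;q). -/
def nStar10 (z q : ℂ) : ℂ := nGen10 z q / (1 - z)

/-- N(1,1/q,z;q²), the M2-rank generating function for overpartitions. -/
def nGenM2over (z q : ℂ) : ℂ :=
  ∑' n : ℕ, qPochN (-1) (q^2) n * qPochN (-q) (q^2) n * q ^ n /
    (qPochN (z * q^2) (q^2) n * qPochN (z⁻¹ * q^2) (q^2) n)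

/-- N*(1,1/q,z;q²). -/
def nStarM2over (z q : ℂ) : ℂ := nGenM2over z q / (1 - z)

/-- N(0,1/q,z;q²), the M2-rank generating function for partitions without repeated odd parts. -/
def nGenM2 (z q : ℂ) : ℂ :=
  ∑' n : ℕ, qPochN (-q) (q^2) n * q ^ (n^2) /
    (qPochN (z * q^2) (q^2) n * qPochN (z⁻¹ * q^2) (q^2) n)

/-- N*(0,1/q,z;q²). -/
def nStarM2 (z q : ℂ) : ℂ := nGenM2 z q / (1 - z)

/-- The odd-rank generating function R^o(z;q). -/
def oddRank (z q : ℂ) : ℂ :=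
  (qPochInf (q^2) (q^2))⁻¹ * ∑' n : ℤ, (-1 : ℂ) ^ n * q ^ (3 * n^2 + 3 * n + 1) / (1 - z * q ^ (2 * n + 1))

/-- The exponent `r (r - 1) / 2`, for integers `r`. -/
def qTri (r : ℤ) : ℤ := r * (r - 1) / 2

theorem two_mul_qTri (r : ℤ) : 2 * qTri r = r * (r - 1) :=
  Int.mul_ediv_cancel' (Int.even_mul_pred_self r).two_dvd

theorem qTri_add_one (r : ℤ) : qTri (r + 1) = qTri r + r := by
  linarith [two_mul_qTri r, two_mul_qTri (r + 1)]

theorem qTri_sub_one (r : ℤ) : qTri (r - 1) = qTri r - (r - 1) := by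
  linarith [two_mul_qTri r, two_mul_qTri (r - 1)]

theorem qTri_neg (r : ℤ) : qTri (-r) = qTri r + r := by
  linarith [two_mul_qTri r, two_mul_qTri (-r)]

theorem summable_norm_mul_pow {q : ℂ} (hq : ‖q‖ < 1) (a : ℂ) :
    Summable fun n : ℕ => ‖-(a * q ^ n)‖ := by
  simp only [norm_neg, norm_mul, norm_pow]
  exact (summable_geometric_of_lt_one (norm_nonneg q) hq).mul_left _

theorem multipliable_one_sub_mul_pow {q : ℂ} (hq : ‖q‖ < 1) (a : ℂ) :
    Multipliable fun n : ℕ => 1 - a * q ^ n := by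
  simpa only [sub_eq_add_neg] using multipliable_one_add_of_summable (summable_norm_mul_pow hq a)

theorem tendsto_qPochN {q : ℂ} (hq : ‖q‖ < 1) (a : ℂ) :
    Tendsto (qPochN a q) atTop (nhds (qPochInf a q)) :=
  (multipliable_one_sub_mul_pow hq a).hasProd.tendsto_prod_nat

theorem qPochInf_ne_zero {q : ℂ} (hq : ‖q‖ < 1) {a : ℂ} (h : ∀ n : ℕ, 1 - a * q ^ n ≠ 0) :
    qPochInf a q ≠ 0 := by
  have := tprod_one_add_ne_zero_of_summable (f := fun n : ℕ => -(a * q ^ n))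
    (by simpa only [← sub_eq_add_neg] using h) (summable_norm_mul_pow hq a)
  simpa only [← sub_eq_add_neg, qPochInf] using this

theorem qPochN_ne_zero {q a : ℂ} (h : ∀ n : ℕ, 1 - a * q ^ n ≠ 0) (n : ℕ) :
    qPochN a q n ≠ 0 :=
  Finset.prod_ne_zero_iff.2 fun j _ => h j

theorem qPochN_zero (a q : ℂ) : qPochN a q 0 = 1 := Finset.prod_range_zero _

theorem qPochN_succ (a q : ℂ) (n : ℕ) :
    qPochN a q (n + 1) = qPochN a q n * (1 - a * q ^ n) := Finset.prod_range_succ _ _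

theorem qPochN_succ' (a q : ℂ) (n : ℕ) :
    qPochN a q (n + 1) = (1 - a) * qPochN (a * q) q n := by
  rw [qPochN, Finset.prod_range_succ', mul_comm]
  simp [qPochN, pow_succ', mul_assoc]

theorem qPochN_add (a q : ℂ) (m n : ℕ) :
    qPochN a q (m + n) = qPochN a q m * qPochN (a * q ^ m) q n := by
  rw [qPochN, Finset.prod_range_add]
  simp [qPochN, pow_add, mul_assoc]

theorem qPochInf_eq_mul {q : ℂ} (hq : ‖q‖ < 1) (a : ℂ) :
    qPochInf a q = (1 - a) * qPochInf (a * q) q := by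
  refine tendsto_nhds_unique ((tendsto_add_atTop_iff_nat 1).2 (tendsto_qPochN hq a)) ?_
  simp only [qPochN_succ']
  exact (tendsto_qPochN hq (a * q)).const_mul _

theorem qPochInf_eq_qPochN_mul {q : ℂ} (hq : ‖q‖ < 1) (a : ℂ) (m : ℕ) :
    qPochInf a q = qPochN a q m * qPochInf (a * q ^ m) q := by
  refine tendsto_nhds_unique ((tendsto_add_atTop_iff_nat m).2 (tendsto_qPochN hq a)) ?_
  simp only [add_comm _ m, qPochN_add]
  exact (tendsto_qPochN hq (a * q ^ m)).const_mul _

theorem exists_norm_le_of_tendsto {f : ℕ → ℂ} {a : ℂ} (h : Tendsto f atTop (nhds a)) :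
    ∃ K : ℝ, ∀ n, ‖f n‖ ≤ K := by
  obtain ⟨K, hK⟩ := (Metric.isBounded_range_of_tendsto f h).exists_norm_le
  exact ⟨K, fun n => hK _ ⟨n, rfl⟩⟩

theorem one_sub_mul_pow_ne_zero {q a : ℂ} (hq : ‖q‖ < 1) (ha : ‖a‖ < 1) (n : ℕ) :
    1 - a * q ^ n ≠ 0 := by
  intro h
  have h1 : ‖a * q ^ n‖ = 1 := by rw [← sub_eq_zero.1 h, norm_one]
  have h2 : ‖a * q ^ n‖ < 1 := by
    rw [norm_mul, norm_pow]
    exact (mul_le_of_le_one_right (norm_nonneg _) (pow_le_one₀ (norm_nonneg _) hq.le)).trans_lt ha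
  exact h2.ne h1

theorem zpow_ne_one_of_norm_lt_one {q : ℂ} (hq : ‖q‖ < 1) {r : ℤ} (hr : r ≠ 0) :
    q ^ r ≠ 1 := by
  intro h
  have h1 : ‖q‖ ^ r = 1 := by rw [← norm_zpow, h, norm_one]
  rcases (zpow_eq_one_iff_of_ne_zero₀ hr).1 h1 with h2 | h2
  · exact hq.ne h2
  · linarith [norm_nonneg q, h2.1]

/-- The reciprocal of `(q; q)_m`, extended by zero to negative `m`. -/
def qPochRecip (q : ℂ) (m : ℤ) : ℂ := if m < 0 then 0 else (qPochN q q m.toNat)⁻¹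

theorem qPochRecip_natCast (q : ℂ) (m : ℕ) : qPochRecip q m = (qPochN q q m)⁻¹ := by
  simp [qPochRecip]

theorem qPochRecip_of_neg (q : ℂ) {m : ℤ} (hm : m < 0) : qPochRecip q m = 0 := by
  simp [qPochRecip, hm]

theorem qPochRecip_zero (q : ℂ) : qPochRecip q 0 = 1 := by
  simp [qPochRecip, qPochN]

theorem qPochRecip_sub_one {q : ℂ} (hq : ‖q‖ < 1) (m : ℤ) :
    qPochRecip q (m - 1) = (1 - q ^ m) * qPochRecip q m := by
  rcases lt_trichotomy m 0 with h | rfl | h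
  · rw [qPochRecip_of_neg q h, qPochRecip_of_neg q (by omega), mul_zero]
  · rw [qPochRecip_of_neg q (by omega), zpow_zero, sub_self, zero_mul]
  · obtain ⟨k, rfl⟩ : ∃ k : ℕ, m = k + 1 := ⟨(m - 1).toNat, by omega⟩
    have h1 := one_sub_mul_pow_ne_zero hq hq k
    have h2 := qPochN_ne_zero (one_sub_mul_pow_ne_zero hq hq) k
    rw [add_sub_cancel_right, qPochRecip_natCast, ← Nat.cast_succ, qPochRecip_natCast,
      zpow_natCast, Nat.succ_eq_add_one, qPochN_succ, pow_succ']
    field_simp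

theorem tendsto_qPochRecip {q : ℂ} (hq : ‖q‖ < 1) :
    Tendsto (fun n : ℕ => qPochRecip q n) atTop (nhds (qPochInf q q)⁻¹) := by
  simp only [qPochRecip_natCast]
  exact (tendsto_qPochN hq q).inv₀ (qPochInf_ne_zero hq (one_sub_mul_pow_ne_zero hq hq))

theorem exists_norm_qPochRecip_le {q : ℂ} (hq : ‖q‖ < 1) :
    ∃ K : ℝ, 0 ≤ K ∧ ∀ m : ℤ, ‖qPochRecip q m‖ ≤ K := by
  obtain ⟨K, hK⟩ := exists_norm_le_of_tendsto (tendsto_qPochRecip hq)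
  have hK0 : 0 ≤ K := (norm_nonneg _).trans (hK 0)
  refine ⟨K, hK0, fun m => ?_⟩
  rcases lt_or_ge m 0 with h | h
  · simpa [qPochRecip_of_neg q h] using hK0
  · lift m to ℕ using h
    exact hK m

theorem tendsto_qPochRecip_sub_mul_add {q : ℂ} (hq : ‖q‖ < 1) (r : ℤ) :
    Tendsto (fun n : ℕ => qPochRecip q (n - r) * qPochRecip q (n + r)) atTop
      (nhds (((qPochInf q q)⁻¹) ^ 2)) := by
  have key : ∀ s : ℤ, Tendsto (fun n : ℕ => qPochRecip q (n + s)) atTop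
      (nhds (qPochInf q q)⁻¹) := by
    intro s
    have h1 : Tendsto (fun n : ℕ => ((n : ℤ) + s).toNat) atTop atTop := by
      refine tendsto_atTop.2 fun b => ?_
      filter_upwards [eventually_ge_atTop (b + s.natAbs)] with n hn
      omega
    refine ((tendsto_qPochRecip hq).comp h1).congr' ?_
    filter_upwards [eventually_ge_atTop s.natAbs] with n hn
    simp only [Function.comp]
    congr 1
    omega
  rw [sq]
  simpa only [sub_eq_add_neg] using (key (-r)).mul (key r)

/-- The terms `z ^ r * q ^ (r (r - 1) / 2)` of a theta series are summable over `ℤ`. -/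
theorem summable_zpow_mul_zpow_qTri {q : ℂ} (hq0 : q ≠ 0) (hq : ‖q‖ < 1) {z : ℂ} (hz : z ≠ 0) :
    Summable fun r : ℤ => z ^ r * q ^ qTri r := by
  have key : ∀ w : ℂ, w ≠ 0 → Summable fun n : ℕ => w ^ (n : ℤ) * q ^ qTri n := by
    intro w hw
    refine summable_of_ratio_test_tendsto_lt_one (l := 0) one_pos
      (Eventually.of_forall fun n => mul_ne_zero (zpow_ne_zero _ hw) (zpow_ne_zero _ hq0)) ?_
    have h : ∀ n : ℕ, ‖w ^ ((n + 1 : ℕ) : ℤ) * q ^ qTri ((n + 1 : ℕ) : ℤ)‖ /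
        ‖w ^ (n : ℤ) * q ^ qTri n‖ = ‖w‖ * ‖q‖ ^ n := by
      intro n
      have h1 : w ^ (n : ℤ) * q ^ qTri n ≠ 0 := mul_ne_zero (zpow_ne_zero _ hw) (zpow_ne_zero _ hq0)
      rw [← norm_div, ← norm_pow, ← norm_mul, Nat.cast_succ, qTri_add_one, zpow_add₀ hq0,
        zpow_add₀ hw, zpow_one, zpow_natCast q n]
      congr 1
      field_simp
    simp only [h]
    simpa using (tendsto_pow_atTop_nhds_zero_of_lt_one (norm_nonneg q) hq).const_mul ‖w‖
  refine Summable.of_nat_of_neg (key z hz) ?_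
  have h2 := key (z⁻¹ * q) (mul_ne_zero (inv_ne_zero hz) hq0)
  refine h2.congr fun n => ?_
  rw [qTri_neg, zpow_add₀ hq0, mul_zpow, inv_zpow, zpow_neg]
  ring

theorem hasSum_of_eq {ι : Type*} {f g : ι → ℂ} {a b : ℂ} (hf : HasSum f a) (h : ∀ i, g i = f i)
    (hab : b = a) : HasSum g b := by
  rwa [funext h, hab]

/-- Reciprocal `q`-factorials restrict a sum over `ℤ` to the finite range `-n ≤ r ≤ n`. -/
theorem hasSum_mul_qPochRecip_zero (q : ℂ) (f : ℤ → ℂ) :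
    HasSum (fun r : ℤ => f r * (qPochRecip q ((0 : ℕ) - r) * qPochRecip q ((0 : ℕ) + r)))
      (f 0) := by
  convert hasSum_single (f := fun r : ℤ => f r *
    (qPochRecip q ((0 : ℕ) - r) * qPochRecip q ((0 : ℕ) + r))) 0 ?_ using 1
  · simp [qPochRecip_zero]
  · intro r hr
    rcases lt_or_gt_of_ne hr with h | h
    · rw [qPochRecip_of_neg q (show ((0 : ℕ) : ℤ) + r < 0 by omega), mul_zero, mul_zero]
    · rw [qPochRecip_of_neg q (show ((0 : ℕ) : ℤ) - r < 0 by omega), zero_mul, mul_zero]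

/-- The finite form of the Jacobi triple product. -/
theorem hasSum_finite_tripleProduct {q : ℂ} (hq0 : q ≠ 0) (hq : ‖q‖ < 1) {z : ℂ} (hz : z ≠ 0)
    (n : ℕ) :
    HasSum (fun r : ℤ => (-z) ^ r * q ^ qTri r * (qPochRecip q (n - r) * qPochRecip q (n + r)))
      (qPochN z q n * qPochN (z⁻¹ * q) q n / qPochN q q (2 * n)) := by
  have hz' : -z ≠ 0 := neg_ne_zero.2 hz
  induction n with
  | zero =>
    convert hasSum_mul_qPochRecip_zero q (fun r : ℤ => (-z) ^ r * q ^ qTri r) using 1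
    simp [qPochN, qTri]
  | succ n ih =>
    have h1 := one_sub_mul_pow_ne_zero hq hq (2 * n)
    have h2 := one_sub_mul_pow_ne_zero hq hq (2 * n + 1)
    have hs := (((ih.mul_left (1 + q ^ (2 * n + 1))).sub
      (((Equiv.subRight (1 : ℤ)).hasSum_iff.2 ih).mul_left (z * q ^ n))).sub
      (((Equiv.addRight (1 : ℤ)).hasSum_iff.2 ih).mul_left (z⁻¹ * q ^ (n + 1)))).mul_left
      (((1 - q * q ^ (2 * n)) * (1 - q * q ^ (2 * n + 1)))⁻¹)
    refine hasSum_of_eq hs (fun r => ?_) ?_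
    · simp only [Function.comp, Equiv.subRight_apply, Equiv.coe_addRight]
      rw [inv_mul_eq_div, eq_div_iff (mul_ne_zero h1 h2)]
      have e1 : qPochRecip q (n - r) = (1 - q ^ ((n : ℤ) + 1 - r)) *
          qPochRecip q (n + 1 - r) := by
        rw [← qPochRecip_sub_one hq]; congr 1; ring
      have e2 : qPochRecip q (n + r) = (1 - q ^ ((n : ℤ) + 1 + r)) *
          qPochRecip q (n + 1 + r) := by
        rw [← qPochRecip_sub_one hq]; congr 1; ring
      have e3 : qPochRecip q (n + (r - 1)) = (1 - q ^ ((n : ℤ) + r)) * qPochRecip q (n + r) := by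
        rw [← qPochRecip_sub_one hq]; congr 1; ring
      have e4 : qPochRecip q (n - (r + 1)) = (1 - q ^ ((n : ℤ) - r)) * qPochRecip q (n - r) := by
        rw [← qPochRecip_sub_one hq]; congr 1; ring
      rw [e3, e4, e1, e2, show (n : ℤ) - (r - 1) = n + 1 - r by ring,
        show (n : ℤ) + (r + 1) = n + 1 + r by ring, Nat.cast_succ, qTri_add_one, qTri_sub_one]
      simp only [zpow_add₀ hq0, zpow_sub₀ hq0, zpow_add₀ hz', zpow_sub₀ hz', zpow_one,
        zpow_natCast]
      field_simp
      ring
    · rw [show 2 * (n + 1) = 2 * n + 1 + 1 by ring]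
      simp only [qPochN_succ]
      have h3 := qPochN_ne_zero (one_sub_mul_pow_ne_zero hq hq) (2 * n)
      field_simp
      ring

/-- The terms of the Lerch-type series `∑ (-1) ^ r * q ^ (r (r + 1) / 2) / (1 - z * q ^ r)`. -/
def lerchTerm (z q : ℂ) (r : ℤ) : ℂ := (-1) ^ r * q ^ (qTri r + r) / (1 - z * q ^ r)

theorem inv_mul_zpow_ne_one {q z : ℂ} (h : ∀ r : ℤ, z * q ^ r ≠ 1) (r : ℤ) :
    z⁻¹ * q ^ r ≠ 1 := by
  intro h1
  refine h (-r) ?_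
  rw [zpow_neg, ← inv_inv z, ← mul_inv, h1, inv_one]

/-- The partial fraction expansion of `1 / ((z; q)_{n + 1} (q / z; q)_n)`. -/
theorem hasSum_lerchTerm_mul {q : ℂ} (hq0 : q ≠ 0) (hq : ‖q‖ < 1) {z : ℂ} (hz : z ≠ 0)
    (h : ∀ r : ℤ, z * q ^ r ≠ 1) (n : ℕ) :
    HasSum (fun r : ℤ => lerchTerm z q r * (qPochRecip q (n - r) * qPochRecip q (n + r)))
      (qPochN z q (n + 1) * qPochN (z⁻¹ * q) q n)⁻¹ := by
  have h' := inv_mul_zpow_ne_one h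
  induction n with
  | zero =>
    convert hasSum_mul_qPochRecip_zero q (lerchTerm z q) using 1
    simp [qPochN, lerchTerm, qTri]
  | succ n ih =>
    have h1 : 1 - z * q ^ (n + 1) ≠ 0 := sub_ne_zero.2 (by exact_mod_cast (h (n + 1)).symm)
    have h2 : 1 - z⁻¹ * q ^ (n + 1) ≠ 0 := sub_ne_zero.2 (by exact_mod_cast (h' (n + 1)).symm)
    have h0 := hasSum_finite_tripleProduct hq0 hq one_ne_zero (n + 1)
    rw [qPochN_succ', sub_self, zero_mul, zero_mul, zero_div] at h0
    have h0' := hasSum_finite_tripleProduct hq0 hq hq0 (n + 1)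
    rw [qPochN_succ' (q⁻¹ * q), inv_mul_cancel₀ hq0, sub_self, zero_mul, mul_zero,
      zero_div] at h0'
    have hs := (ih.add ((h0.sub (h0'.mul_left z⁻¹)).mul_left (q ^ (n + 1)))).mul_left
      (((1 - z * q ^ (n + 1)) * (1 - z⁻¹ * q ^ (n + 1)))⁻¹)
    refine hasSum_of_eq hs (fun r => ?_) ?_
    · have h3 : 1 - z * q ^ r ≠ 0 := sub_ne_zero.2 (h r).symm
      have e1 : qPochRecip q (n - r) = (1 - q ^ ((n : ℤ) + 1 - r)) *
          qPochRecip q (n + 1 - r) := by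
        rw [← qPochRecip_sub_one hq]; congr 1; ring
      have e2 : qPochRecip q (n + r) = (1 - q ^ ((n : ℤ) + 1 + r)) *
          qPochRecip q (n + 1 + r) := by
        rw [← qPochRecip_sub_one hq]; congr 1; ring
      rw [inv_mul_eq_div, eq_div_iff (mul_ne_zero h1 h2), Nat.cast_succ, e1, e2, lerchTerm]
      have key : (1 - z * q ^ (n + 1)) * (1 - z⁻¹ * q ^ (n + 1)) =
          q ^ (n + 1) / q ^ r * ((1 - z * q ^ r) * (1 - z⁻¹ * q ^ r)) +
            (1 - q ^ ((n : ℤ) + 1 - r)) * (1 - q ^ ((n : ℤ) + 1 + r)) := by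
        simp only [zpow_add₀ hq0, zpow_sub₀ hq0, zpow_one, zpow_natCast]
        field_simp
        ring
      have e3 : (-q) ^ r = (-1) ^ r * q ^ r := by rw [← mul_zpow, neg_one_mul]
      rw [key, zpow_add₀ hq0 (qTri r) r, e3]
      generalize 1 - q ^ ((n : ℤ) + 1 - r) = c
      generalize 1 - q ^ ((n : ℤ) + 1 + r) = d
      have hx : q ^ r ≠ 0 := zpow_ne_zero _ hq0
      generalize q ^ r = x at h3 hx
      have h4 : 1 - x * z ≠ 0 := by rwa [mul_comm x]
      field_simp
      ring
    · simp only [qPochN_succ]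
      rw [mul_zero, sub_zero, mul_zero, add_zero, ← mul_inv, pow_succ']
      congr 1
      ring

theorem tendsto_tsum_mul_qPochRecip {q : ℂ} (hq : ‖q‖ < 1) {f : ℤ → ℂ} (hf : Summable f) :
    Tendsto (fun n : ℕ => ∑' r : ℤ, f r * (qPochRecip q (n - r) * qPochRecip q (n + r))) atTop
      (nhds ((∑' r : ℤ, f r) * ((qPochInf q q)⁻¹) ^ 2)) := by
  obtain ⟨K, hK0, hK⟩ := exists_norm_qPochRecip_le hq
  rw [← tsum_mul_right]
  refine tendsto_tsum_of_dominated_convergence (bound := fun r => ‖f r‖ * (K * K))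
    (hf.norm.mul_right _) (fun r => (tendsto_qPochRecip_sub_mul_add hq r).const_mul _)
    (Eventually.of_forall fun n r => ?_)
  rw [norm_mul, norm_mul]
  have h1 := hK (n - r)
  have h2 := hK (n + r)
  gcongr

theorem summable_neg_zpow_mul_zpow_qTri {q : ℂ} (hq0 : q ≠ 0) (hq : ‖q‖ < 1) {z : ℂ}
    (hz : z ≠ 0) : Summable fun r : ℤ => (-z) ^ r * q ^ qTri r :=
  summable_zpow_mul_zpow_qTri hq0 hq (neg_ne_zero.2 hz)

/-- The Jacobi triple product. -/
theorem tsum_neg_zpow_mul_zpow_qTri {q : ℂ} (hq0 : q ≠ 0) (hq : ‖q‖ < 1) {z : ℂ} (hz : z ≠ 0) :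
    ∑' r : ℤ, (-z) ^ r * q ^ qTri r = qPochInf q q * qPochInf z q * qPochInf (z⁻¹ * q) q := by
  have h1 := tendsto_tsum_mul_qPochRecip hq (summable_neg_zpow_mul_zpow_qTri hq0 hq hz)
  simp only [(hasSum_finite_tripleProduct hq0 hq hz _).tsum_eq] at h1
  have hqq := qPochInf_ne_zero hq (one_sub_mul_pow_ne_zero hq hq)
  have h2 := ((tendsto_qPochN hq z).mul (tendsto_qPochN hq (z⁻¹ * q))).div
    ((tendsto_qPochN hq q).comp (tendsto_id.const_mul_atTop' two_pos)) hqq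
  have h3 := tendsto_nhds_unique h1 h2
  field_simp at h3
  rw [h3]
  ring_nf

theorem exists_norm_inv_one_sub_le {q : ℂ} (hq0 : q ≠ 0) (hq : ‖q‖ < 1) {z : ℂ} (hz : z ≠ 0) :
    ∃ K : ℝ, ∀ r : ℤ, ‖(1 - z * q ^ r)⁻¹‖ ≤ K := by
  have hpow := tendsto_pow_atTop_nhds_zero_of_norm_lt_one hq
  have h1 : Tendsto (fun n : ℕ => (1 - z * q ^ n)⁻¹) atTop (nhds (1 - z * 0)⁻¹) :=
    ((hpow.const_mul z).const_sub 1).inv₀ (by simp)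
  have h2 : Tendsto (fun n : ℕ => q ^ n * (q ^ n - z)⁻¹) atTop (nhds (0 * (0 - z)⁻¹)) :=
    hpow.mul ((hpow.sub_const z).inv₀ (by simpa using hz))
  obtain ⟨K, hK⟩ := exists_norm_le_of_tendsto h1
  obtain ⟨L, hL⟩ := exists_norm_le_of_tendsto h2
  refine ⟨max K L, fun r => ?_⟩
  obtain ⟨n, rfl | rfl⟩ := r.eq_nat_or_neg
  · exact (hK n).trans (le_max_left _ _)
  · refine le_trans (le_of_eq ?_) ((hL n).trans (le_max_right _ _))
    have hx : q ^ n ≠ 0 := pow_ne_zero _ hq0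
    rw [zpow_neg, zpow_natCast, show 1 - z * (q ^ n)⁻¹ = (q ^ n)⁻¹ * (q ^ n - z) by field_simp,
      mul_inv, inv_inv]

theorem summable_div_one_sub {q : ℂ} (hq0 : q ≠ 0) (hq : ‖q‖ < 1) {z : ℂ} (hz : z ≠ 0)
    {f : ℤ → ℂ} (hf : Summable f) : Summable fun r : ℤ => f r / (1 - z * q ^ r) := by
  obtain ⟨K, hK⟩ := exists_norm_inv_one_sub_le hq0 hq hz
  refine (hf.norm.mul_right K).of_norm_bounded fun r => ?_
  rw [div_eq_mul_inv, norm_mul]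
  exact mul_le_mul_of_nonneg_left (hK r) (norm_nonneg _)

theorem neg_one_zpow_mul_zpow_add {q : ℂ} (hq0 : q ≠ 0) (r : ℤ) :
    (-1) ^ r * q ^ (qTri r + r) = (-q) ^ r * q ^ qTri r := by
  rw [zpow_add₀ hq0, ← neg_one_mul q, mul_zpow]
  ring

theorem summable_lerchTerm {q : ℂ} (hq0 : q ≠ 0) (hq : ‖q‖ < 1) {z : ℂ} (hz : z ≠ 0) :
    Summable (lerchTerm z q) := by
  refine summable_div_one_sub hq0 hq hz ?_
  simp only [neg_one_zpow_mul_zpow_add hq0]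
  exact summable_neg_zpow_mul_zpow_qTri hq0 hq hq0

/-- The partial fraction expansion of the reciprocal of the theta product. -/
theorem tsum_lerchTerm {q : ℂ} (hq0 : q ≠ 0) (hq : ‖q‖ < 1) {z : ℂ} (hz : z ≠ 0)
    (h : ∀ r : ℤ, z * q ^ r ≠ 1) :
    ∑' r : ℤ, lerchTerm z q r =
      qPochInf q q ^ 2 / (qPochInf z q * qPochInf (z⁻¹ * q) q) := by
  have h1 := tendsto_tsum_mul_qPochRecip hq (summable_lerchTerm hq0 hq hz)
  simp only [(hasSum_lerchTerm_mul hq0 hq hz h _).tsum_eq] at h1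
  have hqq := qPochInf_ne_zero hq (one_sub_mul_pow_ne_zero hq hq)
  have hz1 : qPochInf z q ≠ 0 :=
    qPochInf_ne_zero hq fun n => sub_ne_zero.2 (by exact_mod_cast (h n).symm)
  have hz2 : qPochInf (z⁻¹ * q) q ≠ 0 := by
    refine qPochInf_ne_zero hq fun n => sub_ne_zero.2 ?_
    rw [mul_assoc, ← pow_succ']
    exact_mod_cast (inv_mul_zpow_ne_one h (n + 1)).symm
  have h2 := ((((tendsto_add_atTop_iff_nat 1).2 (tendsto_qPochN hq z)).mul
    (tendsto_qPochN hq (z⁻¹ * q)))).inv₀ (mul_ne_zero hz1 hz2)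
  have h3 := tendsto_nhds_unique h1 h2
  rw [div_eq_mul_inv, ← h3]
  field_simp

/-- The terms of the basic hypergeometric series `₁φ₁(a; ab; q, b)`. -/
def phiTerm (a b q : ℂ) (n : ℕ) : ℂ :=
  qPochN a q n * ((-b) ^ n * q ^ qTri n) / (qPochN q q n * qPochN (a * b) q n)

theorem exists_norm_qPochN_le {q : ℂ} (hq : ‖q‖ < 1) (a : ℂ) :
    ∃ K : ℝ, ∀ n, ‖qPochN a q n‖ ≤ K :=
  exists_norm_le_of_tendsto (tendsto_qPochN hq a)

theorem exists_norm_inv_qPochN_le {q : ℂ} (hq : ‖q‖ < 1) {a : ℂ} (ha : ‖a‖ < 1) :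
    ∃ K : ℝ, ∀ n, ‖(qPochN a q n)⁻¹‖ ≤ K :=
  exists_norm_le_of_tendsto
    ((tendsto_qPochN hq a).inv₀ (qPochInf_ne_zero hq (one_sub_mul_pow_ne_zero hq ha)))

theorem exists_norm_phiTerm_le {q : ℂ} (hq : ‖q‖ < 1) {a b : ℂ} (hab : ‖a * b‖ < 1) :
    ∃ K : ℝ, ∀ N n : ℕ, ‖phiTerm a (b * q ^ N) q n‖ ≤ K * ‖(-b) ^ n * q ^ qTri n‖ := by
  obtain ⟨K₁, h₁⟩ := exists_norm_qPochN_le hq a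
  obtain ⟨K₂, h₂⟩ := exists_norm_inv_qPochN_le hq hq
  obtain ⟨K₃, h₃⟩ := exists_norm_qPochN_le hq (a * b)
  obtain ⟨K₄, h₄⟩ := exists_norm_inv_qPochN_le hq hab
  have p₁ : 0 ≤ K₁ := (norm_nonneg _).trans (h₁ 0)
  have p₂ : 0 ≤ K₂ := (norm_nonneg _).trans (h₂ 0)
  have p₃ : 0 ≤ K₃ := (norm_nonneg _).trans (h₃ 0)
  refine ⟨K₁ * K₂ * K₃ * K₄, fun N n => ?_⟩
  have e : phiTerm a (b * q ^ N) q n = qPochN a q n * (qPochN q q n)⁻¹ * qPochN (a * b) q N *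
      (qPochN (a * b) q (N + n))⁻¹ * ((q ^ N) ^ n * ((-b) ^ n * q ^ qTri n)) := by
    have h := qPochN_ne_zero (one_sub_mul_pow_ne_zero hq hab) N
    rw [qPochN_add, mul_inv, phiTerm, ← neg_mul, mul_pow, mul_assoc a b]
    generalize qPochN (a * b) q N = D at h
    field_simp
  rw [e, norm_mul _ ((q ^ N) ^ n * _), norm_mul ((q ^ N) ^ n), norm_mul, norm_mul, norm_mul]
  have h5 : ‖(q ^ N) ^ n‖ ≤ 1 := by
    rw [norm_pow, norm_pow]
    exact pow_le_one₀ (by positivity) (pow_le_one₀ (norm_nonneg _) hq.le)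
  have h6 : ‖qPochN a q n‖ * ‖(qPochN q q n)⁻¹‖ * ‖qPochN (a * b) q N‖ *
      ‖(qPochN (a * b) q (N + n))⁻¹‖ ≤ K₁ * K₂ * K₃ * K₄ := by
    gcongr
    exacts [h₁ n, h₂ n, h₃ N, h₄ _]
  exact mul_le_mul h6 (mul_le_of_le_one_left (norm_nonneg _) h5) (by positivity)
    ((by positivity : (0 : ℝ) ≤ _).trans h6)

theorem summable_norm_neg_pow_mul_zpow_qTri {q : ℂ} (hq0 : q ≠ 0) (hq : ‖q‖ < 1) {b : ℂ}
    (hb : b ≠ 0) : Summable fun n : ℕ => ‖(-b) ^ n * q ^ qTri n‖ := by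
  have h := (summable_neg_zpow_mul_zpow_qTri hq0 hq hb).norm.comp_injective
    (Nat.cast_injective (R := ℤ))
  simpa only [Function.comp_def, zpow_natCast] using h

theorem summable_phiTerm {q : ℂ} (hq0 : q ≠ 0) (hq : ‖q‖ < 1) {a b : ℂ} (hb : b ≠ 0)
    (hab : ‖a * b‖ < 1) : Summable (phiTerm a b q) := by
  obtain ⟨K, hK⟩ := exists_norm_phiTerm_le hq hab
  refine ((summable_norm_neg_pow_mul_zpow_qTri hq0 hq hb).mul_left K).of_norm_bounded
    fun n => ?_
  simpa using hK 0 n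

theorem phiTerm_contiguous {q : ℂ} (hq0 : q ≠ 0) (hq : ‖q‖ < 1) {a b : ℂ} (hab : ‖a * b‖ < 1)
    (n : ℕ) :
    (1 - a * b) * (q ^ n * phiTerm a b q n + (1 - q ^ (n + 1)) * phiTerm a b q (n + 1)) =
      (1 - b) * phiTerm a (b * q) q n := by
  have h1 := qPochN_ne_zero (one_sub_mul_pow_ne_zero hq hq) n
  have h2 := qPochN_ne_zero (one_sub_mul_pow_ne_zero hq hab) n
  have h3 := one_sub_mul_pow_ne_zero hq hq n
  have h4 := one_sub_mul_pow_ne_zero hq hab n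
  have h5 : 1 - a * b ≠ 0 := by simpa using one_sub_mul_pow_ne_zero hq hab 0
  have e1 : qPochN (a * (b * q)) q n = qPochN (a * b) q n * (1 - a * b * q ^ n) / (1 - a * b) := by
    rw [← qPochN_succ, qPochN_succ', mul_assoc a b]
    field_simp
  rw [pow_succ', phiTerm, phiTerm, phiTerm, e1]
  simp only [qPochN_succ, Nat.cast_succ, qTri_add_one, zpow_add₀ hq0, zpow_natCast, ← neg_mul,
    mul_pow, pow_succ]
  generalize qPochN a q n = A
  generalize qPochN q q n = B at *
  generalize qPochN (a * b) q n = C at *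
  generalize q ^ n = x at *
  have h6 : 1 - x * q ≠ 0 := by rwa [mul_comm x]
  field_simp
  ring

theorem tsum_phiTerm_mul {q : ℂ} (hq0 : q ≠ 0) (hq : ‖q‖ < 1) {a b : ℂ} (hb : b ≠ 0)
    (hab : ‖a * b‖ < 1) :
    (1 - a * b) * ∑' n, phiTerm a b q n = (1 - b) * ∑' n, phiTerm a (b * q) q n := by
  have hs := summable_phiTerm hq0 hq hb hab
  have h1 : Summable fun n => q ^ n * phiTerm a b q n := by
    refine hs.norm.of_norm_bounded fun n => ?_
    rw [norm_mul, norm_pow]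
    exact mul_le_of_le_one_left (norm_nonneg _) (pow_le_one₀ (norm_nonneg _) hq.le)
  have h2 : Summable fun n => (1 - q ^ n) * phiTerm a b q n := by
    simpa only [sub_mul, one_mul] using hs.sub h1
  have h3 := h2.tsum_eq_zero_add
  rw [pow_zero, sub_self, zero_mul, zero_add] at h3
  rw [← tsum_mul_left (a := 1 - b)]
  simp only [← phiTerm_contiguous hq0 hq hab]
  rw [tsum_mul_left, h1.tsum_add ((summable_nat_add_iff 1).2 h2), ← h3, ← h1.tsum_add h2]
  congr 2
  ext n
  ring

/-- The summation of the series `₁φ₁(a; ab; q, b)`. -/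
theorem tsum_phiTerm {q : ℂ} (hq0 : q ≠ 0) (hq : ‖q‖ < 1) {a b : ℂ} (hb : b ≠ 0)
    (hab : ‖a * b‖ < 1) : ∑' n, phiTerm a b q n = qPochInf b q / qPochInf (a * b) q := by
  have hne := qPochInf_ne_zero hq (one_sub_mul_pow_ne_zero hq hab)
  have hpow := tendsto_pow_atTop_nhds_zero_of_norm_lt_one hq
  have step : ∀ N : ℕ, qPochN (a * b) q N * ∑' n, phiTerm a b q n =
      qPochN b q N * ∑' n, phiTerm a (b * q ^ N) q n := by
    intro N
    induction N with
    | zero => simp [qPochN_zero]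
    | succ N ih =>
      have hN : ‖a * (b * q ^ N)‖ < 1 := by
        rw [← mul_assoc, norm_mul, norm_pow]
        exact (mul_le_of_le_one_right (norm_nonneg _)
          (pow_le_one₀ (norm_nonneg _) hq.le)).trans_lt hab
      have h := tsum_phiTerm_mul hq0 hq (mul_ne_zero hb (pow_ne_zero N hq0)) hN
      rw [qPochN_succ, qPochN_succ, mul_right_comm, ih, pow_succ, ← mul_assoc b, mul_assoc _ (1 - _),
        ← h]
      ring
  obtain ⟨K, hK⟩ := exists_norm_phiTerm_le hq hab
  have lim : Tendsto (fun N : ℕ => ∑' n, phiTerm a (b * q ^ N) q n) atTop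
      (nhds (∑' n, phiTerm a 0 q n)) := by
    refine tendsto_tsum_of_dominated_convergence
      ((summable_norm_neg_pow_mul_zpow_qTri hq0 hq hb).mul_left K) (fun n => ?_)
      (Eventually.of_forall hK)
    have hc : ContinuousAt (fun c => phiTerm a c q n) 0 := by
      unfold phiTerm
      refine ContinuousAt.div ?_ ?_ ?_
      · fun_prop
      · unfold qPochN
        fun_prop
      · refine mul_ne_zero (qPochN_ne_zero (one_sub_mul_pow_ne_zero hq hq) n) ?_
        simp [qPochN]
    exact hc.tendsto.comp (by simpa using hpow.const_mul b)
  have h0 : ∑' n, phiTerm a 0 q n = 1 := by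
    rw [tsum_eq_single 0]
    · simp [phiTerm, qPochN, qTri]
    · intro n hn
      simp [phiTerm, hn]
  rw [h0] at lim
  have h1 := ((tendsto_qPochN hq (a * b)).mul_const (∑' n, phiTerm a b q n))
  simp only [step] at h1
  have h2 := tendsto_nhds_unique h1 ((tendsto_qPochN hq b).mul lim)
  rw [eq_div_iff hne, mul_comm, h2, mul_one]

theorem one_add_zpow_ne_zero {q : ℂ} (hq : ‖q‖ < 1) (r : ℤ) : 1 + q ^ r ≠ 0 := by
  intro h
  have h1 : q ^ r = -1 := by linear_combination h
  by_cases hr : r = 0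
  · rw [hr, zpow_zero] at h1
    norm_num at h1
  · refine zpow_ne_one_of_norm_lt_one hq (mul_ne_zero hr two_ne_zero) ?_
    rw [zpow_mul, h1]
    norm_num

/-- The overpartition weights `(-1; q)_n q ^ (n (n + 1) / 2)`. -/
def overWeight (q : ℂ) (n : ℕ) : ℂ := qPochN (-1) q n * q ^ qTri (n + 1)

theorem summable_norm_overWeight {q : ℂ} (hq0 : q ≠ 0) (hq : ‖q‖ < 1) :
    Summable fun n => ‖overWeight q n‖ := by
  obtain ⟨K, hK⟩ := exists_norm_qPochN_le hq (-1)
  refine ((summable_norm_neg_pow_mul_zpow_qTri hq0 hq hq0).mul_left K).of_nonneg_of_le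
    (fun n => norm_nonneg _) fun n => ?_
  have h : ‖q ^ qTri (n + 1)‖ = ‖(-q) ^ n * q ^ qTri n‖ := by
    rw [qTri_add_one, zpow_add₀ hq0, norm_mul, norm_mul, norm_pow, norm_neg, zpow_natCast,
      norm_pow, mul_comm]
  rw [overWeight, norm_mul, h]
  exact mul_le_mul_of_nonneg_right (hK n) (norm_nonneg _)

theorem qTri_add (a b : ℤ) : qTri (a + b) = qTri a + qTri b + a * b := by
  linarith [two_mul_qTri a, two_mul_qTri b, two_mul_qTri (a + b),
    show (a + b) * (a + b - 1) = a * (a - 1) + b * (b - 1) + 2 * (a * b) by ring]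

theorem tsum_overWeight_mul_nat {q : ℂ} (hq0 : q ≠ 0) (hq : ‖q‖ < 1) (r : ℕ) :
    ∑' n : ℕ, overWeight q n * (qPochRecip q (n - r) * qPochRecip q (n + r)) =
      2 * (qPochInf (-q) q / qPochInf q q) * (q ^ qTri (r + 1) / (1 + q ^ r)) := by
  have hqr : ∀ k : ℕ, ‖q * q ^ k‖ < 1 := fun k => by
    rw [← pow_succ', norm_pow]
    exact pow_lt_one₀ (norm_nonneg _) hq (Nat.succ_ne_zero k)
  have hab : -q ^ r * -(q * q ^ r) = q * q ^ (2 * r) := by ring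
  have hinj := (add_left_injective r : Function.Injective fun m : ℕ => m + r)
  rw [← hinj.tsum_eq]
  · have hterm : ∀ m : ℕ, overWeight q (m + r) * (qPochRecip q ((m + r : ℕ) - r) *
        qPochRecip q ((m + r : ℕ) + r)) = qPochN (-1) q r * q ^ qTri (r + 1) / qPochN q q (2 * r) *
          phiTerm (-q ^ r) (-(q * q ^ r)) q m := by
      intro m
      rw [show ((m + r : ℕ) : ℤ) - r = m by push_cast; ring,
        show ((m + r : ℕ) : ℤ) + r = (2 * r + m : ℕ) by push_cast; ring, qPochRecip_natCast,
        qPochRecip_natCast, overWeight, phiTerm, hab, add_comm m r, qPochN_add, qPochN_add,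
        show ((r + m : ℕ) : ℤ) + 1 = (r + 1) + m by push_cast; ring, qTri_add (r + 1) m,
        zpow_add₀ hq0, zpow_add₀ hq0, neg_neg, ← pow_succ' q (2 * r), neg_one_mul]
      have h1 : q ^ (((r : ℤ) + 1) * m) = q ^ ((r + 1) * m) := by exact_mod_cast zpow_natCast q _
      rw [h1, pow_mul q (r + 1) m, pow_succ' q r]
      field_simp
    simp only [hterm]
    have hb : -(q * q ^ r) ≠ 0 := neg_ne_zero.2 (mul_ne_zero hq0 (pow_ne_zero _ hq0))
    rw [tsum_mul_left, tsum_phiTerm hq0 hq hb (by rw [hab]; exact hqr _), hab]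
    have e1 := qPochInf_eq_qPochN_mul hq q (2 * r)
    have e2 := qPochInf_eq_qPochN_mul hq (-1) r
    rw [qPochInf_eq_mul hq (-1), qPochInf_eq_mul hq (-1 * q ^ r)] at e2
    have n1 := qPochN_ne_zero (one_sub_mul_pow_ne_zero hq hq) (2 * r)
    have n2 := qPochInf_ne_zero hq (one_sub_mul_pow_ne_zero hq (hqr (2 * r)))
    have n3 : 1 + q ^ r ≠ 0 := by exact_mod_cast one_add_zpow_ne_zero hq r
    rw [show -1 * q = -q by ring, show -1 * q ^ r * q = -(q * q ^ r) by ring] at e2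
    rw [e1]
    field_simp
    linear_combination (-1 : ℂ) * e2
  · intro n hn
    by_contra hcon
    apply hn
    have h : n < r := by
      by_contra! h
      exact hcon ⟨n - r, Nat.sub_add_cancel h⟩
    change overWeight q n * (qPochRecip q (n - r) * qPochRecip q (n + r)) = 0
    rw [qPochRecip_of_neg q (by omega), zero_mul, mul_zero]

theorem tsum_overWeight_mul {q : ℂ} (hq0 : q ≠ 0) (hq : ‖q‖ < 1) (r : ℤ) :
    ∑' n : ℕ, overWeight q n * (qPochRecip q (n - r) * qPochRecip q (n + r)) =
      2 * (qPochInf (-q) q / qPochInf q q) * (q ^ (qTri r + r) / (1 + q ^ r)) := by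
  obtain ⟨k, rfl | rfl⟩ := r.eq_nat_or_neg
  · rw [tsum_overWeight_mul_nat hq0 hq, qTri_add_one, zpow_natCast q k]
  · have h := tsum_overWeight_mul_nat hq0 hq k
    have n3 : 1 + q ^ k ≠ 0 := by exact_mod_cast one_add_zpow_ne_zero hq k
    have n4 : q ^ k + 1 ≠ 0 := by rwa [add_comm]
    simp only [sub_neg_eq_add, ← sub_eq_add_neg, mul_comm (qPochRecip q (_ + _))]
    rw [h, qTri_neg, qTri_add_one, add_sub_cancel_right, zpow_add₀ hq0, zpow_neg, zpow_natCast q k]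
    have hx : q ^ k ≠ 0 := pow_ne_zero _ hq0
    generalize q ^ k = x at *
    rw [show 1 + x⁻¹ = (1 + x) / x by field_simp; ring]
    field_simp

theorem summable_lerchTerm_mul_overWeight {q : ℂ} (hq0 : q ≠ 0) (hq : ‖q‖ < 1) {z : ℂ}
    (hz : z ≠ 0) :
    Summable (Function.uncurry fun (n : ℕ) (r : ℤ) => overWeight q n *
      (lerchTerm z q r * (qPochRecip q (n - r) * qPochRecip q (n + r)))) := by
  obtain ⟨K, hK0, hK⟩ := exists_norm_qPochRecip_le hq
  have hs := ((summable_norm_overWeight hq0 hq).mul_of_nonneg (summable_lerchTerm hq0 hq hz).norm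
    (fun _ => norm_nonneg _) (fun _ => norm_nonneg _)).mul_right (K * K)
  refine hs.of_norm_bounded ?_
  rintro ⟨n, r⟩
  simp only [Function.uncurry_apply_pair, norm_mul, ← mul_assoc]
  rw [mul_assoc, mul_assoc _ K]
  exact mul_le_mul_of_nonneg_left
    (mul_le_mul (hK _) (hK _) (norm_nonneg _) hK0) (by positivity)

theorem nStar10_eq_tsum_lerchTerm {q : ℂ} (hq0 : q ≠ 0) (hq : ‖q‖ < 1) {z : ℂ} (hz : z ≠ 0)
    (h : ∀ r : ℤ, z * q ^ r ≠ 1) :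
    nStar10 z q = 2 * (qPochInf (-q) q / qPochInf q q) *
      ∑' r : ℤ, lerchTerm z q r * (q ^ (qTri r + r) / (1 + q ^ r)) := by
  have h1 : ∀ n : ℕ, qPochN (-1) q n * q ^ (n * (n + 1) / 2) /
      (qPochN (z * q) q n * qPochN (z⁻¹ * q) q n) / (1 - z) =
      ∑' r : ℤ, overWeight q n *
        (lerchTerm z q r * (qPochRecip q (n - r) * qPochRecip q (n + r))) := by
    intro n
    rw [tsum_mul_left, (hasSum_lerchTerm_mul hq0 hq hz h n).tsum_eq, qPochN_succ', overWeight]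
    have e : qTri ((n : ℤ) + 1) = ((n * (n + 1) / 2 : ℕ) : ℤ) := by
      rw [qTri]; push_cast; congr 1; ring
    rw [e, zpow_natCast, div_div, div_eq_mul_inv]
    congr 2
    ring
  rw [nStar10, nGen10, ← tsum_div_const, tsum_congr h1,
    ← (summable_lerchTerm_mul_overWeight hq0 hq hz).tsum_comm, ← tsum_mul_left]
  refine tsum_congr fun r => ?_
  rw [tsum_congr fun n : ℕ => mul_left_comm (overWeight q n) _ _, tsum_mul_left,
    tsum_overWeight_mul hq0 hq]
  ring

/-- The bilateral sum `∑ (-1) ^ r * q ^ (r ^ 2)`. -/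
def altTheta (q : ℂ) : ℂ := ∑' r : ℤ, (-1) ^ r * q ^ (r ^ 2)

theorem norm_sq_lt_one {q : ℂ} (hq : ‖q‖ < 1) : ‖q ^ 2‖ < 1 := by
  rw [norm_pow]; exact pow_lt_one₀ (norm_nonneg _) hq two_ne_zero

theorem neg_one_zpow_mul_zpow_sq {q : ℂ} (hq0 : q ≠ 0) (r : ℤ) :
    (-1) ^ r * q ^ (r ^ 2) = (-q) ^ r * (q ^ 2) ^ qTri r := by
  rw [show -q = -1 * q by ring, mul_zpow, ← zpow_natCast q 2, ← zpow_mul, mul_assoc,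
    ← zpow_add₀ hq0]
  congr 2
  have := two_mul_qTri r
  push_cast
  linarith

theorem summable_altTheta {q : ℂ} (hq0 : q ≠ 0) (hq : ‖q‖ < 1) :
    Summable fun r : ℤ => (-1) ^ r * q ^ (r ^ 2) := by
  simp only [neg_one_zpow_mul_zpow_sq hq0]
  exact summable_neg_zpow_mul_zpow_qTri (pow_ne_zero 2 hq0) (norm_sq_lt_one hq) hq0

theorem altTheta_eq_qPochInf {q : ℂ} (hq0 : q ≠ 0) (hq : ‖q‖ < 1) :
    altTheta q = qPochInf (q ^ 2) (q ^ 2) * qPochInf q (q ^ 2) ^ 2 := by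
  rw [altTheta, tsum_congr (neg_one_zpow_mul_zpow_sq hq0),
    tsum_neg_zpow_mul_zpow_qTri (pow_ne_zero 2 hq0) (norm_sq_lt_one hq) hq0]
  rw [show q⁻¹ * q ^ 2 = q by field_simp]
  ring

theorem qPochInf_mul_qPochInf_sq {q : ℂ} (hq : ‖q‖ < 1) :
    qPochInf q (q ^ 2) * qPochInf (q ^ 2) (q ^ 2) = qPochInf q q := by
  have hq2 := norm_sq_lt_one hq
  have e := tprod_even_mul_odd (f := fun n : ℕ => 1 - q * q ^ n)
    (by simpa only [pow_mul] using multipliable_one_sub_mul_pow hq2 q)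
    (by
      convert multipliable_one_sub_mul_pow hq2 (q ^ 2) using 2 with n
      ring)
  rw [qPochInf, qPochInf, qPochInf, ← e]
  congr 1
  · simp only [pow_mul]
  · exact tprod_congr fun n => by ring

theorem qPochInf_neg_mul_qPochInf {q : ℂ} (hq : ‖q‖ < 1) :
    qPochInf (-q) q * qPochInf q q = qPochInf (q ^ 2) (q ^ 2) := by
  rw [qPochInf, qPochInf, qPochInf, ← (multipliable_one_sub_mul_pow hq (-q)).tprod_mul
    (multipliable_one_sub_mul_pow hq q)]
  exact tprod_congr fun n => by ring

theorem qPochInf_self_ne_zero {q : ℂ} (hq : ‖q‖ < 1) : qPochInf q q ≠ 0 :=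
  qPochInf_ne_zero hq (one_sub_mul_pow_ne_zero hq hq)

/-- Gauss's product for `∑ (-1) ^ r * q ^ (r ^ 2)`. -/
theorem qPochInf_neg_mul_altTheta {q : ℂ} (hq0 : q ≠ 0) (hq : ‖q‖ < 1) :
    qPochInf (-q) q * altTheta q = qPochInf q q := by
  have h1 := qPochInf_mul_qPochInf_sq hq
  have h2 := qPochInf_neg_mul_qPochInf hq
  have h3 := qPochInf_self_ne_zero (norm_sq_lt_one hq)
  rw [altTheta_eq_qPochInf hq0 hq]
  refine mul_right_cancel₀ h3 ?_
  linear_combination (qPochInf (-q) q *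
    (qPochInf q (q ^ 2) * qPochInf (q ^ 2) (q ^ 2) + qPochInf q q)) * h1 + qPochInf q q * h2

theorem altTheta_ne_zero {q : ℂ} (hq0 : q ≠ 0) (hq : ‖q‖ < 1) : altTheta q ≠ 0 := fun h =>
  qPochInf_self_ne_zero hq (by rw [← qPochInf_neg_mul_altTheta hq0 hq, h, mul_zero])

theorem zpow_qTri_add_mul {q : ℂ} (hq0 : q ≠ 0) (r : ℤ) :
    q ^ (qTri r + r) * q ^ (qTri r + r) = q ^ (r ^ 2) * q ^ r := by
  rw [← zpow_add₀ hq0, ← zpow_add₀ hq0]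
  congr 1
  have := two_mul_qTri r
  linarith

theorem hasSum_altTheta_mul_div_one_add {q : ℂ} (hq0 : q ≠ 0) (hq : ‖q‖ < 1) :
    HasSum (fun r : ℤ => (-1) ^ r * q ^ (r ^ 2) * (q ^ r / (1 + q ^ r))) (altTheta q / 2) := by
  have hs : Summable fun r : ℤ => (-1) ^ r * q ^ (r ^ 2) * (q ^ r / (1 + q ^ r)) := by
    have h0 := summable_altTheta hq0 hq
    refine (h0.sub (summable_div_one_sub hq0 hq (neg_ne_zero.2 one_ne_zero) h0)).congr fun r => ?_
    have := one_add_zpow_ne_zero hq r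
    rw [show 1 - -1 * q ^ r = 1 + q ^ r by ring]
    field_simp
    ring
  have h1 := hs.hasSum
  have h2 := (Equiv.neg ℤ).hasSum_iff.2 h1
  have h3 : HasSum (fun r : ℤ => (-1) ^ r * q ^ (r ^ 2)) _ :=
    hasSum_of_eq (h1.add h2) (fun r => ?_) rfl
  · have := h3.tsum_eq
    rw [altTheta, this, add_self_div_two]
    exact h1
  · have h4 := one_add_zpow_ne_zero hq r
    have h5 := zpow_ne_zero r hq0
    simp only [Function.comp_apply, Equiv.neg_apply, neg_sq, zpow_neg, ← inv_zpow, inv_neg, inv_one]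
    rw [inv_zpow]
    generalize q ^ r = x at *
    have h6 : x + 1 ≠ 0 := by rwa [add_comm]
    field_simp
    ring

theorem sq_zpow_eq (q : ℂ) (r : ℤ) : (q ^ 2) ^ r = (q ^ r) ^ 2 := by
  rw [← zpow_natCast, ← zpow_natCast, ← zpow_mul, ← zpow_mul, mul_comm]

theorem summable_neg_one_zpow_mul_div {q : ℂ} (hq0 : q ≠ 0) (hq : ‖q‖ < 1) {z : ℂ} (hz : z ≠ 0) :
    Summable fun r : ℤ => (-1) ^ r * q ^ (r ^ 2) * (q ^ r) ^ 2 / (1 - z ^ 2 * (q ^ 2) ^ r) := by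
  have hq2 := norm_sq_lt_one hq
  have hq20 := pow_ne_zero 2 hq0
  refine summable_div_one_sub hq20 hq2 (pow_ne_zero 2 hz) ?_
  refine (summable_neg_zpow_mul_zpow_qTri hq20 hq2 (pow_ne_zero 3 hq0)).congr fun r => ?_
  rw [neg_one_zpow_mul_zpow_sq hq0, show -q ^ 3 = -q * q ^ 2 by ring, mul_zpow, sq_zpow_eq q r]
  ring

theorem nStar10_eq_altTheta_add {q : ℂ} (hq0 : q ≠ 0) (hq : ‖q‖ < 1) {z : ℂ} (hz : z ≠ 0)
    (h : ∀ r : ℤ, z ^ 2 * (q ^ 2) ^ r ≠ 1) :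
    nStar10 z q = (1 + z)⁻¹ * (qPochInf (-q) q / qPochInf q q) *
      (altTheta q + 2 * z * ∑' r : ℤ, lerchTerm (z ^ 2) (q ^ 2) r +
        2 * z ^ 2 * ∑' r : ℤ, (-1) ^ r * q ^ (r ^ 2) * (q ^ r) ^ 2 /
          (1 - z ^ 2 * (q ^ 2) ^ r)) := by
  have hz1 : 1 + z ≠ 0 := fun h0 => h 0 (by
    rw [zpow_zero]; linear_combination (z - 1) * h0)
  have h1 : ∀ r : ℤ, z * q ^ r ≠ 1 := fun r hr => h r (by
    rw [sq_zpow_eq, ← mul_pow, hr, one_pow])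
  have hs := (((hasSum_altTheta_mul_div_one_add hq0 hq).add
    ((summable_lerchTerm (pow_ne_zero 2 hq0) (norm_sq_lt_one hq)
      (pow_ne_zero 2 hz)).hasSum.mul_left z)).add
    ((summable_neg_one_zpow_mul_div hq0 hq hz).hasSum.mul_left (z ^ 2))).mul_left (1 + z)⁻¹
  rw [nStar10_eq_tsum_lerchTerm hq0 hq hz h1, (hasSum_of_eq hs (fun r => ?_) rfl).tsum_eq]
  · ring
  · have e := zpow_qTri_add_mul hq0 r
    have e' : (q ^ 2) ^ (qTri r + r) = q ^ (r ^ 2) * q ^ r := by rw [sq_zpow_eq, sq, e]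
    have h2 := h r
    rw [lerchTerm, lerchTerm, div_mul_div_comm, mul_assoc, e, e']
    rw [sq_zpow_eq] at h2 ⊢
    have h3 := one_add_zpow_ne_zero hq r
    have h4 := h1 r
    generalize q ^ r = x at *
    have h5 : 1 - z * x ≠ 0 := sub_ne_zero.2 h4.symm
    have h6 : 1 + z * x ≠ 0 := fun h0 => h2 (by linear_combination (z * x - 1) * h0)
    rw [show 1 - z ^ 2 * x ^ 2 = (1 - z * x) * (1 + z * x) by ring]
    rw [mul_comm z x] at *
    field_simp
    ring

theorem norm_exp_two_pi_I_mul_lt_one {τ : ℂ} (hτ : 0 < τ.im) : ‖exp (2 * π * I * τ)‖ < 1 := by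
  rw [Complex.norm_exp, Real.exp_lt_one_iff]
  have : (2 * π * I * τ).re = -(2 * π * τ.im) := by simp
  rw [this, neg_lt_zero]
  positivity

theorem qTri_cast (r : ℤ) : ((qTri r : ℤ) : ℂ) = r * (r - 1) / 2 := by
  have : ((2 * qTri r : ℤ) : ℂ) = ((r * (r - 1) : ℤ) : ℂ) := by rw [two_mul_qTri]
  push_cast at this
  linear_combination this / 2

theorem jTheta_eq_tsum (v τ : ℂ) :
    jTheta v τ = -I * exp (π * I * τ / 4) * exp (-(π * I * v)) *
      ∑' r : ℤ, (-exp (2 * π * I * v)) ^ r * exp (2 * π * I * τ) ^ qTri r := by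
  rw [jTheta, ← (Equiv.subRight (1 : ℤ)).tsum_eq, ← tsum_mul_left]
  refine tsum_congr fun r => ?_
  have h1 : -exp (2 * π * I * v) = exp (2 * π * I * v + π * I) := by
    rw [Complex.exp_add, exp_pi_mul_I]; ring
  have h2 : -I = exp (-(π / 2 * I)) := by
    rw [Complex.exp_neg, exp_pi_div_two_mul_I, inv_I]
  rw [h1, h2, ← Complex.exp_int_mul, ← Complex.exp_int_mul, ← Complex.exp_add, ← Complex.exp_add,
    ← Complex.exp_add, ← Complex.exp_add, qTri_cast]
  congr 1
  simp only [Equiv.subRight_apply]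
  push_cast
  ring

theorem jTheta_eq_qPochInf {τ : ℂ} (hτ : 0 < τ.im) (v : ℂ) :
    jTheta v τ = -I * exp (π * I * τ / 4) * exp (-(π * I * v)) *
      (qPochInf (exp (2 * π * I * τ)) (exp (2 * π * I * τ)) *
        qPochInf (exp (2 * π * I * v)) (exp (2 * π * I * τ)) *
        qPochInf ((exp (2 * π * I * v))⁻¹ * exp (2 * π * I * τ)) (exp (2 * π * I * τ))) := by
  rw [jTheta_eq_tsum, tsum_neg_zpow_mul_zpow_qTri (Complex.exp_ne_zero _)
    (norm_exp_two_pi_I_mul_lt_one hτ) (Complex.exp_ne_zero _)]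

theorem dedekindEta_eq_qPochInf (τ : ℂ) :
    dedekindEta τ = exp (π * I * τ / 12) *
      qPochInf (exp (2 * π * I * τ)) (exp (2 * π * I * τ)) := by
  rw [dedekindEta, qPochInf]
  congr 1
  refine tprod_congr fun n => ?_
  rw [← Complex.exp_nat_mul, ← Complex.exp_add]
  congr 2
  ring

theorem exp_two_pi_I_mul_two_mul (v : ℂ) : exp (2 * π * I * (2 * v)) = exp (2 * π * I * v) ^ 2 := by
  rw [← Complex.exp_nat_mul]
  congr 1
  push_cast
  ring

theorem jTheta_self_two_mul {τ : ℂ} (hτ : 0 < τ.im) :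
    jTheta τ (2 * τ) = -I * exp (-π * I * τ / 2) * altTheta (exp (2 * π * I * τ)) := by
  rw [jTheta_eq_qPochInf (by simpa using hτ), exp_two_pi_I_mul_two_mul,
    altTheta_eq_qPochInf (Complex.exp_ne_zero _) (norm_exp_two_pi_I_mul_lt_one hτ),
    show -π * I * τ / 2 = π * I * (2 * τ) / 4 + -(π * I * τ) by ring, Complex.exp_add]
  have h := Complex.exp_ne_zero (2 * π * I * τ)
  rw [show (exp (2 * π * I * τ))⁻¹ * exp (2 * π * I * τ) ^ 2 = exp (2 * π * I * τ) by
    field_simp]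
  ring

theorem lerchMu_two_mul (τ u : ℂ) :
    lerchMu (2 * u) τ (2 * τ) = exp (2 * π * I * u) / jTheta τ (2 * τ) *
      ∑' r : ℤ, (-1) ^ r * exp (2 * π * I * τ) ^ (r ^ 2) * (exp (2 * π * I * τ) ^ r) ^ 2 /
        (1 - exp (2 * π * I * u) ^ 2 * (exp (2 * π * I * τ) ^ 2) ^ r) := by
  rw [lerchMu, show π * I * (2 * u) = 2 * π * I * u by ring]
  congr 1
  · refine tsum_congr fun r => ?_
    rw [mul_assoc ((-1 : ℂ) ^ r), ← exp_two_pi_I_mul_two_mul, ← exp_two_pi_I_mul_two_mul]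
    simp only [← Complex.exp_int_mul, ← Complex.exp_nat_mul, ← Complex.exp_add]
    push_cast
    congr 2
    · ring_nf
    · ring_nf

/-- N*(1,0,z;q) in terms of η, ϑ, and the Lerch sum μ. -/
theorem nStar10_lerch (τ u : ℂ) (hτ : 0 < τ.im)
    (hu : ∀ m n : ℤ, u ≠ (m : ℂ) * τ + (n : ℂ) / 2) :
    nStar10 (Complex.exp (2 * π * I * u)) (Complex.exp (2 * π * I * τ))
    = (1 + Complex.exp (2 * π * I * u))⁻¹ *
        (-2 * I * dedekindEta (2 * τ) ^ 4 / (dedekindEta τ ^ 2 * jTheta (2 * u) (2 * τ))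
          - 2 * I * Complex.exp (-π * I * τ / 2) * Complex.exp (2 * π * I * u) *
              lerchMu (2 * u) τ (2 * τ)
          + 1) := by
  have hτ2 : 0 < (2 * τ).im := by simpa using hτ
  have hq := norm_exp_two_pi_I_mul_lt_one hτ
  have hq0 := Complex.exp_ne_zero (2 * π * I * τ)
  have hz0 := Complex.exp_ne_zero (2 * π * I * u)
  have h : ∀ r : ℤ, exp (2 * π * I * u) ^ 2 * (exp (2 * π * I * τ) ^ 2) ^ r ≠ 1 := by
    intro r hr
    rw [← exp_two_pi_I_mul_two_mul, ← exp_two_pi_I_mul_two_mul, ← Complex.exp_int_mul,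
      ← Complex.exp_add, Complex.exp_eq_one_iff] at hr
    obtain ⟨n, hn⟩ := hr
    have hpi : (2 * π * I : ℂ) ≠ 0 := Complex.two_pi_I_ne_zero
    refine hu (-r) n (mul_left_cancel₀ hpi ?_)
    push_cast
    linear_combination hn / 2
  have hη : exp (π * I * (2 * τ) / 12) ^ 4 =
      exp (π * I * τ / 12) ^ 2 * exp (π * I * (2 * τ) / 4) := by
    rw [← Complex.exp_nat_mul, ← Complex.exp_nat_mul, ← Complex.exp_add]
    congr 1
    push_cast
    ring
  have hv : exp (-(π * I * (2 * u))) = (exp (2 * π * I * u))⁻¹ := by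
    rw [← Complex.exp_neg]
    congr 1
    ring
  rw [nStar10_eq_altTheta_add hq0 hq hz0 h,
    tsum_lerchTerm (pow_ne_zero 2 hq0) (norm_sq_lt_one hq) (pow_ne_zero 2 hz0) h,
    lerchMu_two_mul, jTheta_self_two_mul hτ, jTheta_eq_qPochInf hτ2, dedekindEta_eq_qPochInf,
    dedekindEta_eq_qPochInf, mul_pow, mul_pow, hη, hv, exp_two_pi_I_mul_two_mul,
    exp_two_pi_I_mul_two_mul]
  have hA := altTheta_ne_zero hq0 hq
  have hG := qPochInf_neg_mul_altTheta hq0 hq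
  have hE := qPochInf_neg_mul_qPochInf hq
  have hP := qPochInf_self_ne_zero hq
  have hQ := qPochInf_self_ne_zero (norm_sq_lt_one hq)
  have hQ1 : qPochInf (exp (2 * π * I * u) ^ 2) (exp (2 * π * I * τ) ^ 2) ≠ 0 :=
    qPochInf_ne_zero (norm_sq_lt_one hq) fun n =>
      sub_ne_zero.2 (by exact_mod_cast (h n).symm)
  have hQ2 : qPochInf ((exp (2 * π * I * u) ^ 2)⁻¹ * exp (2 * π * I * τ) ^ 2)
      (exp (2 * π * I * τ) ^ 2) ≠ 0 :=
    qPochInf_ne_zero (norm_sq_lt_one hq) fun n => sub_ne_zero.2 (by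
      rw [mul_assoc, ← pow_succ']
      exact_mod_cast (inv_mul_zpow_ne_one h (n + 1)).symm)
  have h12 := Complex.exp_ne_zero (π * I * τ / 12)
  have h4 := Complex.exp_ne_zero (π * I * (2 * τ) / 4)
  have hh := Complex.exp_ne_zero (-π * I * τ / 2)
  generalize qPochInf ((exp (2 * π * I * u) ^ 2)⁻¹ * exp (2 * π * I * τ) ^ 2)
      (exp (2 * π * I * τ) ^ 2) = J2 at *
  generalize qPochInf (exp (2 * π * I * u) ^ 2) (exp (2 * π * I * τ) ^ 2) = J1 at *
  generalize ∑' r : ℤ, (-1) ^ r * exp (2 * π * I * τ) ^ (r ^ 2) * (exp (2 * π * I * τ) ^ r) ^ 2 /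
        (1 - exp (2 * π * I * u) ^ 2 * (exp (2 * π * I * τ) ^ 2) ^ r) = S at *
  have hI := I_ne_zero
  generalize altTheta (exp (2 * π * I * τ)) = A at *
  generalize qPochInf (-exp (2 * π * I * τ)) (exp (2 * π * I * τ)) = N at *
  generalize qPochInf (exp (2 * π * I * τ)) (exp (2 * π * I * τ)) = P at *
  generalize qPochInf (exp (2 * π * I * τ) ^ 2) (exp (2 * π * I * τ) ^ 2) = E at *
  generalize exp (π * I * τ / 12) = a at *
  generalize exp (π * I * (2 * τ) / 4) = b at *
  generalize exp (-π * I * τ / 2) = c at *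
  generalize exp (2 * π * I * u) = z at *
  clear h hu hv hη
  have hE' : E = P ^ 2 / A := by
    rw [← hE, eq_div_iff hA]
    linear_combination P * hG
  have hN : N / P = 1 / A := by
    rw [div_eq_div_iff hP hA, hG, one_mul]
  have e1 : -2 * I * (a ^ 2 * b * E ^ 4) / (a ^ 2 * P ^ 2 * (-I * b * z⁻¹ * (E * J1 * J2))) =
      2 * z * (E ^ 2 / (J1 * J2)) / A := by
    rw [hE']
    field_simp
  have e2 : 2 * I * c * z * (z / (-I * c * A) * S) = -(2 * z ^ 2 * S / A) := by
    field_simp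
  rw [mul_assoc, hN, e1, e2]
  congr 1
  field_simp
  ring

end
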